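/- arXiv:2109.00999 — 3 statements merged into one kernel-verified Lean document; each statement's English description precedes it below -/
import Mathlib

section
/- Let μ_1 < μ_2 < ⋯ < μ_p be real numbers. There exists a positive integer N such that for all integers k, n with |k| ≥ N, all indices i, j ∈ {1, …, p} with (n, i) ≠ (k, j), and all t ∈ [0, π]: if (2πk + t)² + μ_j = (2πn + t)² + μ_i, then n = −k or n = −k − 1. -/
open Real Set

/-- If neither `k - n` nor `k + n` vanishes, then `|k| ≤ |k - n| * |k + n|`. -/
lemma abs_le_abs_sub_mul_abs_add {k n : ℤ} (h₁ : k - n ≠ 0) (h₂ : k + n ≠ 0) :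
    |k| ≤ |k - n| * |k + n| := by
  have ha : 1 ≤ |k - n| := Int.one_le_abs h₁
  have hb : 1 ≤ |k + n| := Int.one_le_abs h₂
  have hsum : 2 * |k| ≤ |k - n| + |k + n| := by
    have h := abs_add_le (k - n) (k + n)
    rwa [show k - n + (k + n) = 2 * k by ring, abs_mul, abs_two] at h
  nlinarith [mul_nonneg (sub_nonneg.2 ha) (sub_nonneg.2 hb)]

/-- For `t ∈ [0, π]` and an integer `m` other than `0` and `-1`, the distance from `t` to `-π m`
is at least `|m|`. -/
lemma abs_le_abs_pi_mul_add {m : ℤ} (h₀ : m ≠ 0) (h₁ : m ≠ -1) {t : ℝ} (ht : t ∈ Icc 0 π) :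
    |(m : ℝ)| ≤ |π * m + t| := by
  obtain ⟨ht₀, ht₁⟩ := ht
  have hπ := pi_gt_three
  rcases (by lia : 1 ≤ m ∨ m ≤ -2) with hm | hm
  · have hm' : (1 : ℝ) ≤ m := by exact_mod_cast hm
    rw [abs_of_nonneg (by linarith)]
    exact le_trans (by nlinarith) (le_abs_self _)
  · have hm' : (m : ℝ) ≤ -2 := by exact_mod_cast hm
    rw [abs_of_nonpos (by linarith)]
    exact le_trans (by nlinarith) (neg_le_abs _)

/-- The gap between `(2πk + t)²` and `(2πn + t)²` is at least `|k|` unless `n` is one of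
`k`, `-k`, `-k - 1`. -/
lemma abs_le_abs_sq_sub_sq {k n : ℤ} (h₁ : n ≠ k) (h₂ : n ≠ -k) (h₃ : n ≠ -k - 1) {t : ℝ}
    (ht : t ∈ Icc 0 π) :
    |(k : ℝ)| ≤ |(2 * π * k + t) ^ 2 - (2 * π * n + t) ^ 2| := by
  have hprod : |(k : ℝ)| ≤ |(k : ℝ) - n| * |(k : ℝ) + n| := by
    exact_mod_cast abs_le_abs_sub_mul_abs_add (k := k) (n := n) (by lia) (by lia)
  have hshift : |(k : ℝ) + n| ≤ |π * (k + n) + t| := by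
    exact_mod_cast abs_le_abs_pi_mul_add (m := k + n) (by lia) (by lia) ht
  have hfac : (2 * π * k + t) ^ 2 - (2 * π * n + t) ^ 2
      = 4 * π * ((k - n) * (π * (k + n) + t)) := by ring
  rw [hfac, abs_mul, abs_of_pos (by positivity : 0 < 4 * π), abs_mul]
  calc |(k : ℝ)| ≤ |(k : ℝ) - n| * |π * (k + n) + t| :=
        hprod.trans (by gcongr)
    _ ≤ 4 * π * (|(k : ℝ) - n| * |π * (k + n) + t|) :=
        le_mul_of_one_le_left (by positivity) (by linarith [pi_gt_three])

/-- For `μ_1 < ⋯ < μ_p`, there is `N > 0` such that for all `|k| ≥ N`,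
all indices `i, j` with `(n, i) ≠ (k, j)` and all `t ∈ [0, π]`, the equality
`(2πk + t)² + μ_j = (2πn + t)² + μ_i` forces `n = −k` or `n = −k − 1`. -/
theorem large_exceptional_indices {p : ℕ} (μ : Fin p → ℝ) (hμ : StrictMono μ) :
    ∃ N : ℕ, 0 < N ∧
      ∀ (k n : ℤ) (i j : Fin p) (t : ℝ), (N : ℤ) ≤ |k| → t ∈ Set.Icc 0 π →
        (n, i) ≠ (k, j) →
        (2 * π * k + t) ^ 2 + μ j = (2 * π * n + t) ^ 2 + μ i →
        n = -k ∨ n = -k - 1 := by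
  obtain ⟨B, hB⟩ := (finite_range fun x : Fin p × Fin p => |μ x.1 - μ x.2|).bddAbove
  obtain ⟨N, hN⟩ := exists_nat_gt B
  refine ⟨N + 1, N.succ_pos, fun k n i j t hk ht hne heq => ?_⟩
  have hgap : |μ i - μ j| ≤ B := hB ⟨(i, j), rfl⟩
  have hk' : (N : ℝ) + 1 ≤ |(k : ℝ)| := by exact_mod_cast hk
  by_contra! h
  have hnk : n ≠ k := by
    rintro rfl
    exact hne (by rw [hμ.injective (add_left_cancel heq)])
  have hle := abs_le_abs_sq_sub_sq hnk h.1 h.2 ht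
  rw [show (2 * π * k + t) ^ 2 - (2 * π * n + t) ^ 2 = μ i - μ j by linarith] at hle
  linarith
end

section
/- Let μ_1 < μ_2 < ⋯ < μ_p be real numbers and let ε : ℤ → (0, ∞) be a sequence with ε_n → 0 as |n| → ∞. For |k| ≥ 2 define δ_k = max{ε_k, ε_{−k}, ε_{−k−1}} / (2π(2|k| − 2)). Then there exists N₂ such that for every integer k with |k| > N₂, every j ∈ {1, …, p}, and every t ∈ [0, π] satisfying |t − t(2k, j, i)| ≥ δ_k and |t − t(2k+1, j, i)| ≥ δ_k for all i ∈ {1, …, p}, the following holds: for every integer n with |n| ≥ N₂ and every i ∈ {1, …, p} with (n, i) ≠ (k, j), the closed intervals [μ_{k,j}(t) − ε_k, μ_{k,j}(t) + ε_k] and [μ_{n,i}(t) − ε_n, μ_{n,i}(t) + ε_n] are disjoint. -/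
open Real Set

/-- Closed intervals whose centres are further apart than the sum of the radii are disjoint. -/
lemma disjoint_Icc_of_add_lt_abs_sub {x y a b : ℝ} (h : a + b < |x - y|) :
    Disjoint (Set.Icc (x - a) (x + a)) (Set.Icc (y - b) (y + b)) := by
  rw [Set.disjoint_left]
  rintro z ⟨h1, h2⟩ ⟨h3, h4⟩
  rcases lt_abs.mp h with h | h <;> linarith

/-- If `|d| + |s| ≥ 2 |k|` with `d = k - n` and `s = k + n`, both nonzero, then
`|d| * |s| ≥ 2 |k| - 1`. -/
lemma two_mul_abs_sub_one_le_abs_mul_abs {k n : ℤ} (hd : k - n ≠ 0) (hs : k + n ≠ 0) :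
    2 * |k| - 1 ≤ |k - n| * |k + n| := by
  have h1 := Int.one_le_abs hd
  have h2 := Int.one_le_abs hs
  have h3 : 2 * |k| ≤ |k - n| + |k + n| := by
    have h := abs_add_le (k - n) (k + n)
    rwa [show k - n + (k + n) = 2 * k by ring, abs_mul, abs_two] at h
  nlinarith [mul_nonneg (sub_nonneg.2 h1) (sub_nonneg.2 h2)]

/-- For `t ∈ [0, π]`, the squares `(2πk + t)²` and `(2πn + t)²` are far apart unless
`n ∈ {k, -k, -k - 1}`. -/
lemma two_mul_abs_sub_one_le_abs_sq_sub_sq {k n : ℤ} {t : ℝ} (ht : t ∈ Set.Icc (0 : ℝ) π)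
    (h1 : n ≠ k) (h2 : n ≠ -k) (h3 : n ≠ -k - 1) :
    2 * |(k : ℝ)| - 1 ≤ |(2 * π * k + t) ^ 2 - (2 * π * n + t) ^ 2| := by
  obtain ⟨ht0, htπ⟩ := ht
  have hπ := Real.pi_gt_three
  have hmul : 2 * |(k : ℝ)| - 1 ≤ |(k : ℝ) - n| * |(k : ℝ) + n| := by
    exact_mod_cast two_mul_abs_sub_one_le_abs_mul_abs (k := k) (n := n) (by omega) (by omega)
  have hs : |(k : ℝ) + n| ≤ |2 * π * ((k : ℝ) + n) + 2 * t| := by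
    rcases (by omega : 1 ≤ k + n ∨ k + n ≤ -2) with h | h
    · have h' : (1 : ℝ) ≤ (k : ℝ) + n := by exact_mod_cast h
      rw [abs_of_nonneg (by linarith)]
      exact le_trans (by nlinarith) (le_abs_self _)
    · have h' : (k : ℝ) + n ≤ -2 := by exact_mod_cast h
      rw [abs_of_nonpos (by linarith)]
      exact le_trans (by nlinarith) (neg_le_abs _)
  have hd : |(k : ℝ) - n| ≤ |2 * π * ((k : ℝ) - n)| := by
    rw [abs_mul, abs_of_pos (by linarith : 0 < 2 * π)]
    nlinarith [abs_nonneg ((k : ℝ) - n)]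
  rw [show (2 * π * k + t) ^ 2 - (2 * π * n + t) ^ 2
      = (2 * π * ((k : ℝ) - n)) * (2 * π * ((k : ℝ) + n) + 2 * t) by ring, abs_mul]
  exact hmul.trans (mul_le_mul hd hs (abs_nonneg _) (abs_nonneg _))

/-- A lower bound `m / b ≤ |x|` is scaled to a strict lower bound `2 * m < |a * x|`. -/
lemma two_mul_lt_abs_mul_of_div_le {m a b x : ℝ} (hm : 0 < m) (hb : 0 < b) (hab : 2 * b < |a|)
    (h : m / b ≤ |x|) : 2 * m < |a * x| := by
  rw [div_le_iff₀ hb] at h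
  have hx : 0 < |x| := pos_of_mul_pos_left (hm.trans_le h) hb.le
  rw [abs_mul]
  nlinarith

/-- Lemma 1(b): with `δ_k = max{ε_k, ε_{−k}, ε_{−k−1}} / (2π(2|k| − 2))`,
there is `N₂` such that for `|k| > N₂`, `j`, and `t ∈ [0, π]` keeping distance `≥ δ_k`
from all crossing points `t(2k, j, i)`, `t(2k+1, j, i)`, the interval
`[μ_{k,j}(t) − ε_k, μ_{k,j}(t) + ε_k]` is disjoint from `[μ_{n,i}(t) − ε_n, μ_{n,i}(t) + ε_n]`
for all `|n| ≥ N₂` and `(n, i) ≠ (k, j)`. -/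
theorem disjoint_eigenvalue_neighborhoods {p : ℕ} (μ : Fin p → ℝ) (hμ : StrictMono μ)
    (ε : ℤ → ℝ) (hε : ∀ n : ℤ, 0 < ε n)
    (hε0 : ∀ η : ℝ, 0 < η → ∃ M : ℕ, ∀ n : ℤ, (M : ℤ) ≤ |n| → ε n < η) :
    ∃ N₂ : ℕ, ∀ k : ℤ, (N₂ : ℤ) < |k| → ∀ j : Fin p, ∀ t ∈ Set.Icc (0 : ℝ) π,
      (∀ i : Fin p,
          max (max (ε k) (ε (-k))) (ε (-k - 1)) / (2 * π * (2 * |(k : ℝ)| - 2)) ≤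
            |t - (μ i - μ j) / (8 * π * k)| ∧
          max (max (ε k) (ε (-k))) (ε (-k - 1)) / (2 * π * (2 * |(k : ℝ)| - 2)) ≤
            |t - (π + (μ i - μ j) / (4 * π * (2 * k + 1)))|) →
      ∀ n : ℤ, (N₂ : ℤ) ≤ |n| → ∀ i : Fin p, (n, i) ≠ (k, j) →
        Disjoint
          (Set.Icc ((2 * π * k + t) ^ 2 + μ j - ε k) ((2 * π * k + t) ^ 2 + μ j + ε k))
          (Set.Icc ((2 * π * n + t) ^ 2 + μ i - ε n) ((2 * π * n + t) ^ 2 + μ i + ε n)) := by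
  obtain ⟨M₁, hM₁⟩ := hε0 1 one_pos
  have hgap : ∀ q : Fin p × Fin p, ∃ M : ℕ, ∀ n : ℤ, (M : ℤ) ≤ |n| → q.1 ≠ q.2 →
      ε n < |μ q.1 - μ q.2| / 2 := by
    intro q
    by_cases hq : q.1 = q.2
    · exact ⟨0, fun n _ h => absurd hq h⟩
    · obtain ⟨M, hM⟩ := hε0 (|μ q.1 - μ q.2| / 2)
        (half_pos (abs_pos.2 (sub_ne_zero.2 (hμ.injective.ne hq))))
      exact ⟨M, fun n hn _ => hM n hn⟩
  choose M hM using hgap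
  obtain ⟨M₂, hM₂⟩ := Finite.exists_le M
  obtain ⟨C, hC⟩ := Finite.exists_le (fun q : Fin p × Fin p => ⌈|μ q.1 - μ q.2|⌉₊)
  refine ⟨M₁ + M₂ + C + 3, fun k hk j t ht hδ n hn i hne => ?_⟩
  push_cast at hk hn
  apply disjoint_Icc_of_add_lt_abs_sub
  have hπ := Real.pi_gt_three
  have hkR : (C : ℝ) + 3 < |(k : ℝ)| := by
    have h : (C : ℤ) + 3 < |k| := by omega
    exact_mod_cast h
  have hC0 : (0 : ℝ) ≤ C := C.cast_nonneg
  have hb : 0 < 2 * π * (2 * |(k : ℝ)| - 2) := mul_pos (by linarith) (by linarith)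
  obtain ⟨hδ₁, hδ₂⟩ := hδ i
  have hmk : ε k ≤ max (max (ε k) (ε (-k))) (ε (-k - 1)) := by simp
  have hmk' : ε (-k) ≤ max (max (ε k) (ε (-k))) (ε (-k - 1)) := by simp
  have hmk'' : ε (-k - 1) ≤ max (max (ε k) (ε (-k))) (ε (-k - 1)) := by simp
  have hm := (hε k).trans_le hmk
  by_cases h1 : n = k
  · subst h1
    have hij : j ≠ i := fun h => hne (by rw [h])
    have h := hM (j, i) n (by have := hM₂ (j, i); omega) hij
    rw [add_sub_add_left_eq_sub]
    dsimp only at h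
    linarith
  by_cases h2 : n = -k
  · subst h2
    have hk0 : (k : ℝ) ≠ 0 := abs_pos.1 (by linarith)
    have hab : 2 * (2 * π * (2 * |(k : ℝ)| - 2)) < |8 * π * k| := by
      rw [abs_mul, abs_of_pos (by linarith : 0 < 8 * π)]
      linarith
    have h := two_mul_lt_abs_mul_of_div_le hm hb hab hδ₁
    have he : (2 * π * k + t) ^ 2 + μ j - ((2 * π * ((-k : ℤ) : ℝ) + t) ^ 2 + μ i)
        = 8 * π * k * (t - (μ i - μ j) / (8 * π * k)) := by
      push_cast
      field_simp
      ring
    rw [he]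
    linarith
  by_cases h3 : n = -k - 1
  · subst h3
    have hk1 : 2 * |(k : ℝ)| - 1 ≤ |2 * (k : ℝ) + 1| := by
      have h := abs_sub_abs_le_abs_sub (2 * (k : ℝ)) (-1)
      rwa [abs_mul, abs_two, abs_neg, abs_one, sub_neg_eq_add] at h
    have hk0 : 2 * (k : ℝ) + 1 ≠ 0 := abs_pos.1 (by linarith)
    have hab : 2 * (2 * π * (2 * |(k : ℝ)| - 2)) < |4 * π * (2 * k + 1)| := by
      rw [abs_mul, abs_of_pos (by linarith : 0 < 4 * π)]
      nlinarith
    have h := two_mul_lt_abs_mul_of_div_le hm hb hab hδ₂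
    have he : (2 * π * k + t) ^ 2 + μ j - ((2 * π * ((-k - 1 : ℤ) : ℝ) + t) ^ 2 + μ i)
        = 4 * π * (2 * k + 1) * (t - (π + (μ i - μ j) / (4 * π * (2 * k + 1)))) := by
      push_cast
      field_simp
      ring
    rw [he]
    linarith
  have hsq := two_mul_abs_sub_one_le_abs_sq_sub_sq ht h1 h2 h3
  have hεk := hM₁ k (by omega)
  have hεn := hM₁ n (by omega)
  have hμC : |μ i - μ j| ≤ C := (Nat.le_ceil _).trans (Nat.cast_le.2 (hC (i, j)))
  have htri := abs_sub_abs_le_abs_sub ((2 * π * k + t) ^ 2 - (2 * π * n + t) ^ 2) (μ i - μ j)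
  rw [show (2 * π * k + t) ^ 2 + μ j - ((2 * π * n + t) ^ 2 + μ i)
    = (2 * π * k + t) ^ 2 - (2 * π * n + t) ^ 2 - (μ i - μ j) by ring]
  linarith
end

section
/- Let a < b be real numbers and for each n ∈ ℕ let λ_n : [a, b] → ℝ be continuous, with λ_n(t) ≤ λ_{n+1}(t) for all n and all t ∈ [a, b]. Let g : [a, b] → ℝ be continuous, ε > 0, and r a positive integer. Suppose that for every t ∈ [a, b]: (i) neither g(t) − ε nor g(t) + ε equals λ_n(t) for any n, and (ii) exactly r indices n satisfy λ_n(t) ∈ (g(t) − ε, g(t) + ε). Then there exists an integer l ≥ 0 such that for every t ∈ [a, b] the set of indices n with λ_n(t) ∈ (g(t) − ε, g(t) + ε) equals {l + 1, l + 2, …, l + r}. -/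
open Real Set

/-- Two continuous functions on a preconnected set that never agree there keep their order. -/
theorem IsPreconnected.lt_of_lt_of_forall_ne {X : Type*} [TopologicalSpace X] {s : Set X}
    (hs : IsPreconnected s) {f g : X → ℝ} (hf : ContinuousOn f s) (hg : ContinuousOn g s)
    (hne : ∀ x ∈ s, f x ≠ g x) {x y : X} (hx : x ∈ s) (hy : y ∈ s) (h : f x < g x) :
    f y < g y := by
  by_contra! hge
  obtain ⟨z, hz, hfg⟩ := hs.intermediate_value₂ hx hy hf hg h.le hge
  exact hne z hz hfg

/-- A finite nonempty order-connected set of natural numbers is a block of consecutive integers. -/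
theorem Set.OrdConnected.exists_eq_Ico_add_ncard {S : Set ℕ} (hS : S.OrdConnected)
    (hfin : S.Finite) (hne : S.Nonempty) : ∃ l : ℕ, S = Set.Ico l (l + S.ncard) := by
  obtain ⟨l, hl, hmin⟩ := Set.exists_min_image S id hfin hne
  obtain ⟨m, hm, hmax⟩ := Set.exists_max_image S id hfin hne
  have hlm : l ≤ m := hmin m hm
  have hIco : S = Set.Ico l (m + 1) := by
    ext n
    exact ⟨fun hn => ⟨hmin n hn, Nat.lt_succ_of_le (hmax n hn)⟩,
      fun hn => hS.out hl hm ⟨hn.1, Nat.le_of_lt_succ hn.2⟩⟩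
  have hcard : S.ncard = m + 1 - l := by
    rw [hIco, ← Finset.coe_Ico, Set.ncard_coe_finset, Nat.card_Ico]
  refine ⟨l, ?_⟩
  rw [hcard, Nat.add_sub_cancel' (by lia)]
  exact hIco

/-- if the continuous nondecreasing family `λ_n` (numbered in nondecreasing
order, here indexed by `ℕ` so that `λ_n` is the `(n+1)`-st band function) never hits the
endpoints `g(t) ± ε` and exactly `r` indices satisfy `λ_n(t) ∈ (g(t) − ε, g(t) + ε)` for
every `t ∈ [a, b]`, then there is a fixed block of `r` consecutive indices
`{l+1, …, l+r}` (in 0-based indexing: `{l, …, l+r−1}`) realizing this for every `t`. -/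
theorem index_block_independent_of_t (a b : ℝ) (hab : a < b)
    (lam : ℕ → ℝ → ℝ) (hcont : ∀ n, ContinuousOn (lam n) (Set.Icc a b))
    (hmono : ∀ n, ∀ t ∈ Set.Icc a b, lam n t ≤ lam (n + 1) t)
    (g : ℝ → ℝ) (hg : ContinuousOn g (Set.Icc a b))
    (ε : ℝ) (hε : 0 < ε) (r : ℕ) (hr : 0 < r)
    (hend : ∀ t ∈ Set.Icc a b, ∀ n : ℕ, g t - ε ≠ lam n t ∧ g t + ε ≠ lam n t)
    (hcount : ∀ t ∈ Set.Icc a b,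
      {n : ℕ | lam n t ∈ Set.Ioo (g t - ε) (g t + ε)}.ncard = r) :
    ∃ l : ℕ, ∀ t ∈ Set.Icc a b,
      {n : ℕ | lam n t ∈ Set.Ioo (g t - ε) (g t + ε)} = Set.Ico l (l + r) := by
  have hmem : ∀ s ∈ Set.Icc a b, ∀ t ∈ Set.Icc a b, ∀ n,
      lam n s ∈ Set.Ioo (g s - ε) (g s + ε) → lam n t ∈ Set.Ioo (g t - ε) (g t + ε) :=
    fun s hs t ht n h =>
      ⟨isPreconnected_Icc.lt_of_lt_of_forall_ne (hg.sub continuousOn_const) (hcont n)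
        (fun x hx => (hend x hx n).1) hs ht h.1,
      isPreconnected_Icc.lt_of_lt_of_forall_ne (hcont n) (hg.add continuousOn_const)
        (fun x hx => (hend x hx n).2.symm) hs ht h.2⟩
  have ha : a ∈ Set.Icc a b := Set.left_mem_Icc.2 hab.le
  have hlam : Monotone fun n => lam n a := monotone_nat_of_le_succ fun n => hmono n a ha
  have hpos : 0 < {n : ℕ | lam n a ∈ Set.Ioo (g a - ε) (g a + ε)}.ncard := by
    rwa [hcount a ha]
  have hord : {n : ℕ | lam n a ∈ Set.Ioo (g a - ε) (g a + ε)}.OrdConnected :=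
    Set.ordConnected_Ioo.preimage_mono hlam
  obtain ⟨l, hl⟩ := hord.exists_eq_Ico_add_ncard (Set.finite_of_ncard_pos hpos)
    (Set.nonempty_of_ncard_ne_zero hpos.ne')
  rw [hcount a ha] at hl
  refine ⟨l, fun t ht => ?_⟩
  rw [← hl]
  ext n
  exact ⟨hmem t ht a ha n, hmem a ha t ht n⟩
end
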